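/- There is no nontrivial 2-(v,k,λ) design D with a flag-transitive group G of automorphisms satisfying Hypothesis (H) whose parameter tuple (λ, v, k, c, d, ℓ) equals one of (3, 1156, 36, 34, 34, 2), (4, 1976, 80, 26, 76, 2), or (4, 2116, 48, 46, 46, 2). -/

import Mathlib

section

open Finset MulAction

open scoped Classical

/-- A group `G` acting flag-transitively on a `2`-design with points `Ω` and blocks `𝓑`, and
preserving a map `cls` from points to classes `𝓒` all of whose fibres have `c` elements, such that
a block contains either no point or exactly two points of a given class. -/
structure PairedDesign (G Ω 𝓑 𝓒 : Type*) [Group G] [MulAction G Ω] [MulAction G 𝓑] [MulAction G 𝓒]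
    [Fintype Ω] [Fintype 𝓑] (lam k c : ℕ) where
  pts : 𝓑 → Finset Ω
  cls : Ω → 𝓒
  lam_pos : 0 < lam
  two_lt : 2 < c
  smul_mem : ∀ (g : G) {ω : Ω} {B : 𝓑}, ω ∈ pts B → g • ω ∈ pts (g • B)
  cls_smul : ∀ (g : G) (ω : Ω), cls (g • ω) = g • cls ω
  card_pair : ∀ {α β : Ω}, α ≠ β → #{B | α ∈ pts B ∧ β ∈ pts B} = lam
  card_pts : ∀ B, #(pts B) = k
  card_meet : ∀ {B ω}, ω ∈ pts B → #{β ∈ pts B | cls β = cls ω} = 2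
  card_cls : ∀ Δ, #{ω | cls ω = Δ} = c
  flag : ∀ {B B' : 𝓑} {α α' : Ω}, α ∈ pts B → α' ∈ pts B' → ∃ g : G, g • α = α' ∧ g • B = B'

/-- A `q`-group stabilizing a finite set fixes a number of its elements congruent to its
cardinality. -/
lemma IsPGroup.card_finset_modEq {G X : Type*} [Group G] [MulAction G X] {q : ℕ} [Fact q.Prime]
    {R : Subgroup G} (hR : IsPGroup q R) (S : Finset X) (hS : ∀ g ∈ R, ∀ s ∈ S, g • s ∈ S) :
    #S ≡ #{s ∈ S | ∀ g ∈ R, g • s = s} [MOD q] := by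
  let Y : SubMulAction R X := ⟨S, fun g s hs => hS g g.2 s hs⟩
  have : Finite Y := S.finite_toSet
  have h := hR.card_modEq_card_fixedPoints Y
  have h1 : Nat.card Y = #S := Nat.card_eq_card_toFinset (S : Set X) |>.trans (by simp)
  have h2 : Nat.card (fixedPoints R Y) = #{s ∈ S | ∀ g ∈ R, g • s = s} := by
    rw [← Nat.card_eq_fintype_card.trans (Fintype.card_coe _)]
    refine Nat.card_congr ⟨fun y => ⟨y.1.1, ?_⟩, fun s => ⟨⟨s.1, ?_⟩, ?_⟩, fun _ => rfl, fun _ => rfl⟩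
    · exact mem_filter.2 ⟨y.1.2, fun g hg => congrArg Subtype.val (y.2 ⟨g, hg⟩)⟩
    · exact (mem_filter.1 s.2).1
    · exact fun g => Subtype.ext ((mem_filter.1 s.2).2 g g.2)
  rwa [h1, h2] at h

/-- An element of prime order `q` stabilizing a finite set fixes a number of its elements congruent
to its cardinality. -/
lemma card_finset_modEq_card_fixed {G X : Type*} [Group G] [MulAction G X] {q : ℕ} [Fact q.Prime]
    {x : G} (hx : x ^ q = 1) (S : Finset X) (hS : ∀ s ∈ S, x • s ∈ S) :
    #S ≡ #{s ∈ S | x • s = s} [MOD q] := by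
  have hfin : IsOfFinOrder x := isOfFinOrder_iff_pow_eq_one.2 ⟨q, (Fact.out : q.Prime).pos, hx⟩
  have key : ∀ P : X → Prop, (∀ s, P s → P (x • s)) →
      ∀ g ∈ Subgroup.zpowers x, ∀ s, P s → P (g • s) := by
    intro P hP g hg s hs
    obtain ⟨n, rfl⟩ := Submonoid.mem_powers_iff _ _ |>.1 (hfin.mem_powers_iff_mem_zpowers.2 hg)
    clear hg
    induction n with
    | zero => simpa using hs
    | succ n ih => simpa [pow_succ', mul_smul] using hP _ ih
  have hR : IsPGroup q (Subgroup.zpowers x) := by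
    rintro ⟨g, n, rfl⟩
    refine ⟨1, Subtype.ext ?_⟩
    change (x ^ n) ^ q ^ 1 = 1
    rw [pow_one, ← zpow_natCast, zpow_comm, zpow_natCast, hx, one_zpow]
  have h := hR.card_finset_modEq S (fun g hg s hs => key (· ∈ S) hS g hg s hs)
  have h' : ∀ s, x • s = s ↔ ∀ g ∈ Subgroup.zpowers x, g • s = s := fun s =>
    ⟨fun hs g hg => key (· = s) (by rintro _ rfl; exact hs) g hg s rfl,
      fun hs => hs x (Subgroup.mem_zpowers x)⟩
  simpa only [h'] using h

/-- An element of prime order `q` fixes every element of a stable set of fewer than `q` elements. -/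
lemma smul_eq_of_card_lt {G X : Type*} [Group G] [MulAction G X] {q : ℕ} [Fact q.Prime]
    {x : G} (hx : x ^ q = 1) (S : Finset X) (hS : ∀ s ∈ S, x • s ∈ S) (hq : #S < q) {s : X}
    (hs : s ∈ S) : x • s = s := by
  have h := (card_finset_modEq_card_fixed hx S hS).eq_of_lt_of_lt hq
    ((card_filter_le _ _).trans_lt hq)
  exact (card_filter_eq_iff.1 h.symm) s hs

/-- A `2`-transitive group of degree `2 * p` containing an element of order `p` with `p` fixed
points is `(p + 1)`-transitive. -/
lemma isMultiplyPretransitive_of_card_fixed {G X : Type*} [Group G] [MulAction G X]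
    [Fintype X] (h2 : IsMultiplyPretransitive G X 2) {p : ℕ} [Fact p.Prime] (hp2 : p ≠ 2)
    (hX : Fintype.card X = 2 * p) {x : G} (hx : x ^ p = 1) (hfix : #{a : X | x • a = a} = p) :
    IsMultiplyPretransitive G X (p + 1) := by
  have hp : p.Prime := Fact.out
  have hp1 := hp.two_le
  set s : Set X := {a | x • a = a} with hs
  have hxs : x ∈ fixingSubgroup G s := (mem_fixingSubgroup_iff G).2 fun a ha => ha
  have hcard : #{a : X | x • a ≠ a} = p := by
    have := card_filter_add_card_filter_not (s := (univ : Finset X)) (fun a => x • a = a)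
    rw [hfix, card_univ, hX] at this
    simp only [ne_eq]
    omega
  have htrans : IsPretransitive (fixingSubgroup G s) (SubMulAction.ofFixingSubgroup G s) := by
    refine ⟨fun a b => ?_⟩
    have ha := (SubMulAction.mem_ofFixingSubgroup_iff G).1 a.2
    have hb := (SubMulAction.mem_ofFixingSubgroup_iff G).1 b.2
    set O : Finset X := {e | ∃ g ∈ fixingSubgroup G s, g • a.1 = e} with hO
    have hOs : ∀ e ∈ O, x • e ≠ e := by
      intro e he hxe
      simp only [hO, mem_filter, mem_univ, true_and] at he
      obtain ⟨g, hg, rfl⟩ := he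
      have := (mem_fixingSubgroup_iff G).1 hg _ hxe
      exact ha (MulAction.injective g this ▸ hxe)
    have hmod := card_finset_modEq_card_fixed hx O fun e he => by
      simp only [hO, mem_filter, mem_univ, true_and] at he ⊢
      obtain ⟨g, hg, rfl⟩ := he
      exact ⟨x * g, mul_mem hxs hg, mul_smul _ _ _⟩
    rw [filter_false_of_mem hOs, card_empty, Nat.modEq_zero_iff_dvd] at hmod
    have hpos : 0 < #O := card_pos.2 ⟨a.1, by simpa [hO] using ⟨1, one_mem _, one_smul _ _⟩⟩
    have heq := eq_of_subset_of_card_le (s := O) (t := {a : X | x • a ≠ a})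
      (fun e he => by simpa using hOs e he) (by rw [hcard]; exact Nat.le_of_dvd hpos hmod)
    have hbO : b.1 ∈ O := heq ▸ by simpa [hs] using hb
    simp only [hO, mem_filter, mem_univ, true_and] at hbO
    obtain ⟨g, hg, hgb⟩ := hbO
    exact ⟨⟨g, hg⟩, Subtype.ext hgb⟩
  have hprim : IsPreprimitive (fixingSubgroup G s) (SubMulAction.ofFixingSubgroup G s) := by
    refine IsPreprimitive.of_prime_card ?_
    convert! hp
    rw [← hcard, Nat.card_eq_fintype_card, Fintype.card_subtype]
    simp [SubMulAction.mem_ofFixingSubgroup_iff, hs]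
  obtain ⟨n, rfl⟩ : ∃ n, p = n + 1 := ⟨p - 1, by omega⟩
  have h := (isPreprimitive_of_is_two_pretransitive h2).isMultiplyPreprimitive (s := s) (n := n)
    (by rw [← hfix, ← Set.ncard_coe_finset]; simp [hs])
    (by rw [Nat.card_eq_fintype_card, hX]; omega) hprim
  exact IsMultiplyPreprimitive.isMultiplyPretransitive G X (n + 2)

/-- Subgroups of prime order `p` are conjugate in a group of order not divisible by `p ^ 2`. -/
lemma exists_conj_mem_zpowers {S : Type*} [Group S] [Finite S] {p : ℕ} [Fact p.Prime] {y z : S}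
    (hy : orderOf y = p) (hz : orderOf z = p) (hS : ¬ p ^ 2 ∣ Nat.card S) :
    ∃ s : S, s * z * s⁻¹ ∈ Subgroup.zpowers y := by
  have hp : p.Prime := Fact.out
  have h0 : Nat.card S ≠ 0 := Nat.card_pos.ne'
  have hfac : (Nat.card S).factorization p = 1 := by
    have h1 := hp.factorization_pos_of_dvd h0 (hy ▸ orderOf_dvd_natCard y)
    rw [hp.pow_dvd_iff_le_factorization h0] at hS
    omega
  obtain ⟨s, hs⟩ := exists_smul_eq S
    (Sylow.ofCard (Subgroup.zpowers z) (by rw [Nat.card_zpowers, hz, hfac, pow_one]))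
    (Sylow.ofCard (Subgroup.zpowers y) (by rw [Nat.card_zpowers, hy, hfac, pow_one]))
  refine ⟨s, ?_⟩
  have h := congrArg (fun P : Sylow p S => (P : Subgroup S)) hs
  simp only [Sylow.coe_subgroup_smul, Sylow.coe_ofCard] at h
  rw [← h]
  exact Subgroup.smul_mem_pointwise_smul z (MulAut.conj s) _ (Subgroup.mem_zpowers z)

/-- If `y` has prime order `p` and point stabilizers have order not divisible by `p ^ 2`, then the
normalizer of the group generated by `y` is transitive on the fixed points of `y` in an orbit. -/
lemma card_fixed_dvd_card_normalizer {G X : Type*} [Group G] [Finite G] [MulAction G X] {p : ℕ}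
    [Fact p.Prime] {H : Subgroup G} {y : G} (hyH : y ∈ H) (hy : y ^ p = 1) (hy1 : y ≠ 1)
    {O : Finset X} (hO : ∀ h ∈ H, ∀ a ∈ O, h • a ∈ O)
    (htrans : ∀ a ∈ O, ∀ b ∈ O, ∃ h ∈ H, h • a = b)
    (hstab : ∀ a ∈ O, ¬ p ^ 2 ∣ Nat.card (stabilizer G a)) (hne : ∃ a ∈ O, y • a = a) :
    #{a ∈ O | y • a = a} ∣ Nat.card (Subgroup.normalizer (Subgroup.zpowers y : Set G)) := by
  set N := Subgroup.normalizer (Subgroup.zpowers y : Set G) with hN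
  obtain ⟨a, haO, hya⟩ := hne
  have horb : orbit (H ⊓ N : Subgroup G) a = (({b ∈ O | y • b = b} : Finset X) : Set X) := by
    ext b
    simp only [coe_filter, Set.mem_ofPred_eq]
    constructor
    · rintro ⟨⟨n, hnH, hnN⟩, rfl⟩
      refine ⟨hO n hnH a haO, ?_⟩
      have h1 : n⁻¹ * y * n ∈ Subgroup.zpowers y :=
        (Subgroup.mem_normalizer_iff''.1 hnN y).1 (Subgroup.mem_zpowers y)
      have h2 : n⁻¹ * y * n ∈ stabilizer G a :=
        (Subgroup.zpowers_le.2 (show y ∈ stabilizer G a from hya)) h1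
      change y • n • a = n • a
      rwa [mem_stabilizer_iff, mul_assoc, mul_smul, inv_smul_eq_iff, mul_smul] at h2
    · rintro ⟨hbO, hyb⟩
      obtain ⟨h, hhH, rfl⟩ := htrans a haO b hbO
      set S : Subgroup G := H ⊓ stabilizer G (h • a) with hS
      have hyS : y ∈ S := ⟨hyH, hyb⟩
      have hzS : h * y * h⁻¹ ∈ S := by
        refine ⟨H.mul_mem (H.mul_mem hhH hyH) (H.inv_mem hhH), ?_⟩
        change (h * y * h⁻¹) • h • a = h • a
        rw [mul_smul, inv_smul_smul, mul_smul, hya]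
      have hz1 : (⟨h * y * h⁻¹, hzS⟩ : S) ≠ 1 := by
        intro h'
        have := congrArg Subtype.val h'
        exact hy1 (by simpa using this)
      obtain ⟨⟨s, hsS⟩, hs⟩ := exists_conj_mem_zpowers (S := S) (p := p)
        (y := ⟨y, hyS⟩) (z := ⟨h * y * h⁻¹, hzS⟩)
        (orderOf_eq_prime (Subtype.ext hy) fun h' => hy1 (congrArg Subtype.val h'))
        (orderOf_eq_prime (Subtype.ext (by
          change (h * y * h⁻¹) ^ p = 1
          rw [conj_pow, hy, mul_one, mul_inv_cancel])) hz1)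
        (fun h' => hstab _ hbO (h'.trans (Subgroup.card_dvd_of_le inf_le_right)))
      obtain ⟨i, hi⟩ := hs
      have hi' : y ^ i = s * (h * y * h⁻¹) * s⁻¹ := congrArg Subtype.val hi
      have hn : s * h ∈ N := by
        refine Subgroup.mem_normalizer_fintype ?_
        rintro _ ⟨j, rfl⟩
        refine ⟨i * j, ?_⟩
        change y ^ (i * j) = s * h * y ^ j * (s * h)⁻¹
        rw [zpow_mul, hi', ← conj_zpow]
        congr 1
        group
      refine ⟨⟨s * h, mul_mem hsS.1 hhH, hn⟩, ?_⟩
      change (s * h) • a = h • a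
      rw [mul_smul]
      exact hsS.2
  have h1 : #{b ∈ O | y • b = b} ∣ Nat.card (H ⊓ N : Subgroup G) := by
    rw [← Set.ncard_coe_finset, ← horb, ← index_stabilizer]
    exact Subgroup.index_dvd_card _
  exact h1.trans (Subgroup.card_dvd_of_le inf_le_right)

/-- A group of prime order `q` normalizing a group of prime order `p` centralizes it if `q` does
not divide `p - 1`. -/
lemma exists_commute_of_mem_normalizer {G : Type*} [Group G] [Finite G] {p q : ℕ} [Fact p.Prime]
    [Fact q.Prime] (hpq : ¬ q ∣ p - 1) {y z : G} (hy : y ^ p = 1) (hy1 : y ≠ 1) (hz : z ^ q = 1)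
    (hzN : z ∈ Subgroup.normalizer (Subgroup.zpowers y : Set G)) :
    ∃ w : G, w ^ p = 1 ∧ w ≠ 1 ∧ Commute z w := by
  set S : Finset G := (Subgroup.zpowers y : Set G).toFinite.toFinset.erase 1 with hS
  have hmem : ∀ w, w ∈ S ↔ w ≠ 1 ∧ w ∈ Subgroup.zpowers y := by simp [hS]
  have hcard : #S = p - 1 := by
    rw [hS, card_erase_of_mem (by simp [one_mem]), ← Set.ncard_eq_toFinset_card,
      ← Nat.card_coe_set_eq]
    congr 1
    exact (Nat.card_zpowers y).trans (orderOf_eq_prime hy hy1)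
  have h := card_finset_modEq_card_fixed (q := q) (x := MulAut.conj z)
    (by rw [← map_pow, hz, map_one]) S fun w hw => by
      rw [hmem] at hw ⊢
      refine ⟨?_, (Subgroup.mem_normalizer_iff.1 hzN w).1 hw.2⟩
      simpa using hw.1
  rw [hcard] at h
  have hne : #{w ∈ S | MulAut.conj z • w = w} ≠ 0 := fun h0 => by
    rw [h0] at h
    exact hpq ((Nat.modEq_zero_iff_dvd).1 h)
  obtain ⟨w, hw⟩ := card_pos.1 (Nat.pos_of_ne_zero hne)
  rw [mem_filter, hmem] at hw
  obtain ⟨⟨hw1, ⟨i, rfl⟩⟩, hw2⟩ := hw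
  refine ⟨y ^ i, ?_, hw1, ?_⟩
  · rw [← zpow_natCast, zpow_comm, zpow_natCast, hy, one_zpow]
  · rw [MulAut.smul_def, MulAut.conj_apply, mul_inv_eq_iff_eq_mul] at hw2
    exact hw2

lemma exists_pow_eq_one_of_dvd_card {H : Type*} [Group H] [Finite H] {q : ℕ} [Fact q.Prime]
    (hq : q ∣ Nat.card H) : ∃ x : H, x ^ q = 1 ∧ x ≠ 1 := by
  obtain ⟨x, hx⟩ := exists_prime_orderOf_dvd_card' q hq
  refine ⟨x, hx ▸ pow_orderOf_eq_one x, ?_⟩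
  rintro rfl
  exact (Fact.out : q.Prime).one_lt.ne (hx ▸ orderOf_one.symm)

lemma exists_smul_ne {G Ω : Type*} [Group G] [MulAction G Ω] [FaithfulSMul G Ω] {x : G}
    (hx : x ≠ 1) : ∃ ω : Ω, x • ω ≠ ω := by
  by_contra! h
  exact hx (eq_of_smul_eq_smul (α := Ω) fun ω => by rw [h, one_smul])

lemma card_mul_le_card_of_le_card_fiber {X Y : Type*} {S : Finset X} {T : Finset Y} {f : X → Y}
    {n : ℕ} (h : ∀ b ∈ T, n ≤ #{a ∈ S | f a = b}) : #T * n ≤ #S := by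
  have h1 := card_nsmul_le_sum _ _ _ h
  have h2 := sum_card_fiberwise_eq_card_filter S T f
  rw [smul_eq_mul] at h1
  refine (h1.trans (le_of_eq ?_)).trans (card_filter_le S (fun a => f a ∈ T))
  convert h2

namespace PairedDesign

variable {G Ω 𝓑 𝓒 : Type*} [Group G] [MulAction G Ω] [MulAction G 𝓑] [MulAction G 𝓒]
  [Fintype Ω] [Fintype 𝓑] {lam k c : ℕ} (D : PairedDesign G Ω 𝓑 𝓒 lam k c)

lemma smul_mem_iff (g : G) {ω : Ω} {B : 𝓑} : g • ω ∈ D.pts (g • B) ↔ ω ∈ D.pts B :=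
  ⟨fun h => by simpa using D.smul_mem g⁻¹ h, D.smul_mem g⟩

/-- Every point of a block has a unique mate, the other point of the block in its class. -/
lemma exists_mate {B : 𝓑} {α : Ω} (hα : α ∈ D.pts B) :
    ∃ β ∈ D.pts B, β ≠ α ∧ D.cls β = D.cls α ∧
      ∀ γ ∈ D.pts B, D.cls γ = D.cls α → γ = α ∨ γ = β := by
  obtain ⟨a, b, hab, h⟩ := card_eq_two.1 (D.card_meet hα)
  simp only [Finset.ext_iff, mem_filter, mem_insert, mem_singleton] at h
  have ha := (h a).2 (.inl rfl)
  have hb := (h b).2 (.inr rfl)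
  rcases (h α).1 ⟨hα, rfl⟩ with rfl | rfl
  · exact ⟨b, hb.1, hab.symm, hb.2, fun γ h1 h2 => (h γ).1 ⟨h1, h2⟩⟩
  · exact ⟨a, ha.1, hab, ha.2, fun γ h1 h2 => ((h γ).1 ⟨h1, h2⟩).symm⟩

lemma card_meet_le (B : 𝓑) (Δ : 𝓒) : #{β ∈ D.pts B | D.cls β = Δ} ≤ 2 := by
  rcases eq_empty_or_nonempty {β ∈ D.pts B | D.cls β = Δ} with h | ⟨ω, h⟩
  · simp [h]
  · rw [mem_filter] at h
    rw [← h.2, D.card_meet h.1]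

/-- Counting incident pairs of a block through `γ` and a point of `S`. -/
lemma sum_card_inter {γ : Ω} {S : Finset Ω} (hγ : γ ∉ S) :
    ∑ B with γ ∈ D.pts B, #{ω ∈ S | ω ∈ D.pts B} = lam * #S := by
  have h := sum_card_bipartiteAbove_eq_sum_card_bipartiteBelow (s := S)
    (t := ({B | γ ∈ D.pts B} : Finset 𝓑)) (fun ω B => ω ∈ D.pts B)
  simp only [bipartiteAbove, bipartiteBelow] at h
  rw [← h, mul_comm, ← smul_eq_mul, ← sum_const]
  refine sum_congr rfl fun ω hω => ?_
  rw [filter_filter]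
  exact D.card_pair (by rintro rfl; exact hγ hω)

/-- The number of blocks through a point. -/
lemma card_blocks_through (α : Ω) : #{B | α ∈ D.pts B} = lam * (c - 1) := by
  set S : Finset Ω := {ω | D.cls ω = D.cls α ∧ ω ≠ α} with hS
  have hcard : #S = c - 1 := by
    rw [← D.card_cls (D.cls α), ← card_erase_of_mem (a := α) (by simp)]
    congr 1
    ext ω
    simp [hS, and_comm]
  rw [← hcard, ← D.sum_card_inter (γ := α) (S := S) (by simp [hS]), card_eq_sum_ones]
  refine sum_congr rfl fun B hB => ?_
  obtain ⟨β, hβ, hne, hcl, huniq⟩ := D.exists_mate (mem_filter.1 hB).2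
  rw [eq_comm, card_eq_one]
  refine ⟨β, ?_⟩
  ext ω
  simp only [hS, mem_filter, mem_univ, true_and, mem_singleton]
  constructor
  · rintro ⟨⟨h1, h2⟩, h3⟩
    exact (huniq ω h3 h1).resolve_left h2
  · rintro rfl
    exact ⟨⟨hcl, hne⟩, hβ⟩

lemma exists_block_pair {α β : Ω} (h : α ≠ β) : ∃ B, α ∈ D.pts B ∧ β ∈ D.pts B := by
  have := D.card_pair h
  have h0 : 0 < #{B | α ∈ D.pts B ∧ β ∈ D.pts B} := by rw [this]; exact D.lam_pos
  obtain ⟨B, hB⟩ := card_pos.1 h0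
  exact ⟨B, (mem_filter.1 hB).2⟩

lemma exists_block (α : Ω) : ∃ B, α ∈ D.pts B := by
  have h0 : 0 < #{B | α ∈ D.pts B} := by
    rw [D.card_blocks_through]
    exact Nat.mul_pos D.lam_pos (by have := D.two_lt; omega)
  obtain ⟨B, hB⟩ := card_pos.1 h0
  exact ⟨B, (mem_filter.1 hB).2⟩

lemma exists_cls_eq (Δ : 𝓒) : ∃ α, D.cls α = Δ := by
  have h0 : 0 < #{ω | D.cls ω = Δ} := by rw [D.card_cls]; have := D.two_lt; omega
  obtain ⟨α, hα⟩ := card_pos.1 h0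
  exact ⟨α, (mem_filter.1 hα).2⟩

lemma exists_smul_point (D : PairedDesign G Ω 𝓑 𝓒 lam k c) (α β : Ω) : ∃ g : G, g • α = β := by
  obtain ⟨B, hB⟩ := D.exists_block α
  obtain ⟨B', hB'⟩ := D.exists_block β
  obtain ⟨g, hg, -⟩ := D.flag hB hB'
  exact ⟨g, hg⟩

lemma exists_smul_cls (D : PairedDesign G Ω 𝓑 𝓒 lam k c) (Δ Δ' : 𝓒) : ∃ g : G, g • Δ = Δ' := by
  obtain ⟨α, rfl⟩ := D.exists_cls_eq Δ
  obtain ⟨β, rfl⟩ := D.exists_cls_eq Δ'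
  obtain ⟨g, rfl⟩ := D.exists_smul_point α β
  exact ⟨g, (D.cls_smul g α).symm⟩

/-- The stabilizer of a point is transitive on the other points of its class. -/
lemma exists_smul_mate {α β β' : Ω} (hβ : β ≠ α) (hβ' : β' ≠ α) (h : D.cls β = D.cls α)
    (h' : D.cls β' = D.cls α) : ∃ g : G, g • α = α ∧ g • β = β' := by
  obtain ⟨B, hαB, hβB⟩ := D.exists_block_pair hβ.symm
  obtain ⟨B', hαB', hβB'⟩ := D.exists_block_pair hβ'.symm
  obtain ⟨g, hg, rfl⟩ := D.flag hαB hαB'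
  refine ⟨g, hg, ?_⟩
  obtain ⟨γ, -, -, -, huniq⟩ := D.exists_mate hαB'
  have h1 := (huniq _ hβB' h').resolve_left hβ'
  have h2 := (huniq _ (D.smul_mem g hβB) (by rw [D.cls_smul, h, ← D.cls_smul, hg])).resolve_left
    (fun h3 => hβ (MulAction.injective g (h3.trans hg.symm)))
  rw [h1, h2]

/-- If `g` fixes a block and a class that it meets, and some odd power of `g` is trivial, then `g`
fixes the two common points. -/
lemma smul_eq_of_odd {g : G} {n : ℕ} (hn : Odd n) (hg : g ^ n = 1) {B : 𝓑} (hB : g • B = B) {α : Ω}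
    (hα : α ∈ D.pts B) (hcl : g • D.cls α = D.cls α) : g • α = α := by
  obtain ⟨β, hβ, hne, hcl', huniq⟩ := D.exists_mate hα
  have key : ∀ ω ∈ D.pts B, D.cls ω = D.cls α → g • ω = α ∨ g • ω = β := fun ω hω h =>
    huniq _ (by simpa [hB] using D.smul_mem g hω) (by rw [D.cls_smul, h, hcl])
  rcases key α hα rfl with h | h
  · exact h
  · have h2 : g • β = α := (key β hβ hcl').resolve_right fun h' =>
      hne (MulAction.injective g (h'.trans h.symm))
    obtain ⟨m, rfl⟩ := hn
    have h3 : g ^ 2 • α = α := by rw [pow_two, mul_smul, h, h2]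
    have h4 : (g ^ 2) ^ m • α = α := (stabilizer G α).pow_mem h3 m
    have := congrArg (· • α) hg
    simp only [pow_succ', mul_smul, pow_mul, one_smul] at this
    rwa [h4] at this

section PrimeOrder

variable {q : ℕ} [Fact q.Prime] {x : G}

/-- An element of prime order `q > lam` fixes all blocks through two of its fixed points. -/
lemma smul_block_eq (hx : x ^ q = 1) (hq : lam < q) {α β : Ω} (hαβ : α ≠ β) (hα : x • α = α)
    (hβ : x • β = β) {B : 𝓑} (hαB : α ∈ D.pts B) (hβB : β ∈ D.pts B) : x • B = B := by
  refine smul_eq_of_card_lt hx {B | α ∈ D.pts B ∧ β ∈ D.pts B} ?_ ?_ (by simp [hαB, hβB])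
  · intro B hB
    simp only [mem_filter, mem_univ, true_and] at hB ⊢
    exact ⟨by simpa [hα] using D.smul_mem x hB.1, by simpa [hβ] using D.smul_mem x hB.2⟩
  · rwa [D.card_pair hαβ]

/-- A nontrivial element of prime order greater than `lam` has fewer than `c` fixed points. -/
lemma card_fixed_lt (D : PairedDesign G Ω 𝓑 𝓒 lam k c) (hx : x ^ q = 1) (hq : lam < q)
    (hq2 : q ≠ 2) {γ₀ : Ω}
    (hγ₀ : x • γ₀ ≠ γ₀) :
    #{ω : Ω | x • ω = ω} < c := by
  have hodd : Odd q := (Fact.out : q.Prime).odd_of_ne_two hq2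
  have hc := D.two_lt
  have hlam := D.lam_pos
  by_contra! hf
  by_cases hcase : ∃ γ, x • γ ≠ γ ∧ x • D.cls γ = D.cls γ
  · obtain ⟨γ, hγ, hγc⟩ := hcase
    have h := D.sum_card_inter (γ := γ) (S := {ω | x • ω = ω}) (by simpa using hγ)
    have hle : ∑ B with γ ∈ D.pts B, #{ω ∈ ({ω | x • ω = ω} : Finset Ω) | ω ∈ D.pts B} ≤
        ∑ B with γ ∈ D.pts B, 1 := by
      refine sum_le_sum fun B hB => card_le_one.2 ?_
      intro α hα β hβ
      simp only [mem_filter, mem_univ, true_and] at hα hβ hB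
      by_contra hne
      have hfix := D.smul_block_eq hx hq hne hα.1 hβ.1 hα.2 hβ.2
      exact hγ (D.smul_eq_of_odd hodd hx hfix hB hγc)
    rw [h, ← card_eq_sum_ones, D.card_blocks_through] at hle
    have := Nat.le_of_mul_le_mul_left hle hlam
    omega
  · push Not at hcase
    obtain ⟨α, hα⟩ : ({ω : Ω | x • ω = ω} : Finset Ω).Nonempty := card_pos.1 (by omega)
    simp only [mem_filter, mem_univ, true_and] at hα
    have hcl : ∀ ω, D.cls ω = D.cls α → x • ω = ω := by
      intro ω hω
      by_contra hne
      exact hcase ω hne (by rw [hω, ← D.cls_smul, hα])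
    have h := D.sum_card_inter (γ := γ₀) (S := {ω | D.cls ω = D.cls α})
      (by simpa using fun h => hγ₀ (hcl γ₀ h))
    rw [D.card_cls] at h
    have hle : ∑ B with γ₀ ∈ D.pts B, #{ω ∈ ({ω | D.cls ω = D.cls α} : Finset Ω) | ω ∈ D.pts B} ≤
        ∑ B with γ₀ ∈ D.pts B ∧ x • γ₀ ∈ D.pts B, 2 := by
      rw [← filter_filter]
      refine (sum_le_sum_of_ne_zero ?_).trans (sum_le_sum fun B hB => ?_)
      · intro B hB hne
        simp only [mem_filter, mem_univ, true_and] at hB ⊢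
        refine ⟨hB, ?_⟩
        obtain ⟨ω, hω⟩ := card_pos.1 (Nat.pos_of_ne_zero hne)
        simp only [mem_filter, mem_univ, true_and] at hω
        obtain ⟨β, hβ, hβne, hβcl, -⟩ := D.exists_mate hω.2
        have hfix := D.smul_block_eq hx hq hβne (hcl _ (hβcl.trans hω.1)) (hcl _ hω.1) hβ hω.2
        simpa [hfix] using D.smul_mem x hB
      · refine le_trans (le_of_eq ?_) (D.card_meet_le B (D.cls α))
        congr 1
        ext ω
        simp [and_comm]
    rw [h, sum_const, D.card_pair hγ₀.symm, smul_eq_mul] at hle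
    have := Nat.le_of_mul_le_mul_left hle hlam
    omega

end PrimeOrder

/-- If `c = 2 * p`, then a nontrivial element of order `p` has no fixed points. -/
lemma smul_ne (D : PairedDesign G Ω 𝓑 𝓒 lam k c) {p : ℕ} [Fact p.Prime] (hc : c = 2 * p)
    (hp : lam < p) (hp2 : p ≠ 2) (hv : p ∣ Fintype.card Ω)
    (hlt : 2 * Fintype.card Ω < p * (p - 1) * (k - p)) {x : G} (hx : x ^ p = 1) {γ₀ : Ω}
    (hγ₀ : x • γ₀ ≠ γ₀) (α : Ω) : x • α ≠ α := by
  intro hα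
  have hlam := D.lam_pos
  set F : Finset Ω := {ω | x • ω = ω} with hF
  have hmem : ∀ ω, ω ∈ F ↔ x • ω = ω := by simp [hF]
  have hlt' : #F < 2 * p := hc ▸ D.card_fixed_lt hx hp hp2 hγ₀
  have hsub : ({ω ∈ ({ω | D.cls ω = D.cls α} : Finset Ω) | x • ω = ω} : Finset Ω) ⊆ F := by
    intro ω
    simp only [mem_filter, hmem]
    exact fun h => h.2
  have hdvd : p ∣ #{ω ∈ ({ω | D.cls ω = D.cls α} : Finset Ω) | x • ω = ω} := by
    refine (Nat.ModEq.dvd_iff (card_finset_modEq_card_fixed hx _ ?_) dvd_rfl).1 ?_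
    · intro ω
      simp only [mem_filter, mem_univ, true_and, D.cls_smul]
      intro h
      rw [h, ← D.cls_smul, hα]
    · rw [D.card_cls, hc]
      exact dvd_mul_left _ _
  have hle : p ≤ #{ω ∈ ({ω | D.cls ω = D.cls α} : Finset Ω) | x • ω = ω} :=
    Nat.le_of_dvd (card_pos.2 ⟨α, by simp [hα]⟩) hdvd
  have hdvdF : p ∣ #F :=
    (Nat.ModEq.dvd_iff (card_finset_modEq_card_fixed hx univ (by simp)) dvd_rfl).1 (by simpa)
  have hFp : #F = p := by
    obtain ⟨m, hm⟩ := hdvdF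
    have h1 := hle.trans (card_le_card hsub)
    have h2 : m < 2 := by
      by_contra! h
      nlinarith
    have h3 : m ≠ 0 := by
      rintro rfl
      have := (Fact.out : p.Prime).pos
      omega
    rw [hm, show m = 1 by omega, mul_one]
  have hFcls : ∀ ω ∈ F, D.cls ω = D.cls α := by
    intro ω hω
    rw [← eq_of_subset_of_card_le hsub (by rw [hFp]; exact hle)] at hω
    simpa using (mem_filter.1 hω).1
  set N : Finset 𝓑 := {B | ∃ a ∈ F, ∃ b ∈ F, a ≠ b ∧ a ∈ D.pts B ∧ b ∈ D.pts B} with hN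
  have h1 : #F.offDiag * lam ≤ #N * 2 := by
    refine card_mul_le_card_mul (fun a B => a.1 ∈ D.pts B ∧ a.2 ∈ D.pts B) ?_ ?_
    · rintro ⟨a, b⟩ hab
      rw [mem_offDiag] at hab
      refine (D.card_pair hab.2.2).ge.trans (card_le_card fun B hB => ?_)
      simp only [mem_filter, mem_univ, true_and] at hB
      simp only [bipartiteAbove, mem_filter, hN, mem_univ, true_and]
      exact ⟨⟨a, hab.1, b, hab.2.1, hab.2.2, hB⟩, hB⟩
    · intro B _
      have hsub : F.offDiag.bipartiteBelow (fun a B => a.1 ∈ D.pts B ∧ a.2 ∈ D.pts B) B ⊆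
          ({β ∈ D.pts B | D.cls β = D.cls α} : Finset Ω).offDiag := by
        rintro ⟨a, b⟩
        simp only [bipartiteBelow, mem_filter, mem_offDiag]
        exact fun h => ⟨⟨h.2.1, hFcls a h.1.1⟩, ⟨h.2.2, hFcls b h.1.2.1⟩, h.1.2.2⟩
      refine (card_le_card hsub).trans ?_
      rw [offDiag_card]
      have := D.card_meet_le B (D.cls α)
      interval_cases #{β ∈ D.pts B | D.cls β = D.cls α} <;> norm_num
  have h2 : #N * (k - p) ≤ #(univ \ F) * lam := by
    refine card_mul_le_card_mul (fun B γ => γ ∈ D.pts B) ?_ ?_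
    · intro B _
      have hle := le_card_sdiff F (D.pts B)
      rw [hFp, D.card_pts] at hle
      refine hle.trans (card_le_card fun γ => ?_)
      simp [bipartiteAbove, and_comm]
    · intro γ hγ
      rw [mem_sdiff, hmem] at hγ
      refine (card_le_card fun B => ?_).trans (D.card_pair (Ne.symm hγ.2)).le
      simp only [bipartiteBelow, hN, mem_filter, mem_univ, true_and, hmem]
      rintro ⟨⟨a, ha, b, hb, hab, haB, hbB⟩, hγB⟩
      have hfix := D.smul_block_eq hx hp hab ha hb haB hbB
      exact ⟨hγB, by simpa [hfix] using D.smul_mem x hγB⟩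
  rw [offDiag_card, hFp] at h1
  have h3 : #(univ \ F) ≤ Fintype.card Ω := card_le_univ _
  have h4 : p * p - p = p * (p - 1) := by rw [Nat.mul_sub, mul_one]
  rw [h4] at h1
  have h5 : (p * (p - 1) * (k - p)) * lam ≤ 2 * Fintype.card Ω * lam := by
    calc (p * (p - 1) * (k - p)) * lam = (p * (p - 1) * lam) * (k - p) := by ring
      _ ≤ (#N * 2) * (k - p) := Nat.mul_le_mul_right _ h1
      _ = (#N * (k - p)) * 2 := by ring
      _ ≤ (#(univ \ F) * lam) * 2 := Nat.mul_le_mul_right _ h2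
      _ ≤ (Fintype.card Ω * lam) * 2 := by gcongr
      _ = _ := by ring
  exact absurd (Nat.le_of_mul_le_mul_right h5 hlam) (by omega)

/-- A nontrivial normal subgroup fixing all classes is transitive on each of them. -/
lemma exists_mem_smul_eq (K : Subgroup G) [hK : K.Normal]
    (hcls : ∀ g ∈ K, ∀ Δ : 𝓒, g • Δ = Δ) {a : G} (ha : a ∈ K) {ω : Ω} (hω : a • ω ≠ ω) {α β : Ω}
    (h : D.cls β = D.cls α) : ∃ b ∈ K, b • α = β := by
  by_cases hβ : β = α
  · exact ⟨1, K.one_mem, by simp [hβ]⟩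
  obtain ⟨g, rfl⟩ := D.exists_smul_point ω α
  have hne : (g * a * g⁻¹) • g • ω ≠ g • ω := by
    rw [← mul_smul, inv_mul_cancel_right, mul_smul]
    exact fun h => hω (MulAction.injective g h)
  have hmem := hK.conj_mem a ha g
  obtain ⟨h', h1, h2⟩ := D.exists_smul_mate hne hβ (by rw [D.cls_smul, hcls _ hmem]) h
  refine ⟨h' * (g * a * g⁻¹) * h'⁻¹, hK.conj_mem _ hmem h', ?_⟩
  rw [mul_smul, inv_smul_eq_iff.2 h1.symm, mul_smul, h2]

/-- In a normal subgroup fixing all classes, point stabilizers fix the whole class of the point. -/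
lemma smul_eq_of_cls_eq [Finite G] [Nontrivial 𝓒] (K : Subgroup G) [hK : K.Normal]
    (hcls : ∀ g ∈ K, ∀ Δ : 𝓒, g • Δ = Δ) (hk : 0 < k) (hc : Even c)
    (hQ : ∀ q, q.Prime → q ∣ c - 1 → ¬ q ∣ lam ∨ ¬ q ∣ Fintype.card 𝓑) {α β : Ω}
    (h : D.cls β = D.cls α) {g : G} (hg : g ∈ K) (hgα : g • α = α) : g • β = β := by
  by_contra hgβ
  have hβα : β ≠ α := by rintro rfl; exact hgβ hgα
  set M₁ : Ω → Subgroup G := fun ω => K ⊓ stabilizer G ω with hM₁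
  set M₂ : Ω → Ω → Subgroup G := fun ω ω' => M₁ ω ⊓ stabilizer G ω' with hM₂
  have hmap : ∀ (t : G) (ω : Ω), (M₁ ω).map (MulAut.conj t).toMonoidHom = M₁ (t • ω) := by
    intro t ω
    rw [hM₁]
    simp only
    rw [Subgroup.map_inf_eq _ _ _ (MulAut.conj t).injective, ← stabilizer_smul_eq_stabilizer_map_conj]
    congr 1
    exact Subgroup.Normal.map_conj_eq K t
  have hcard₂ : ∀ (t : G) (ω ω' : Ω), Nat.card (M₂ (t • ω) (t • ω')) = Nat.card (M₂ ω ω') := by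
    intro t ω ω'
    have : (M₂ ω ω').map (MulAut.conj t).toMonoidHom = M₂ (t • ω) (t • ω') := by
      rw [hM₂]
      simp only
      rw [Subgroup.map_inf_eq _ _ _ (MulAut.conj t).injective, hmap,
        ← stabilizer_smul_eq_stabilizer_map_conj]
    rw [← this]
    exact Subgroup.card_map_of_injective (MulAut.conj t).injective
  have hcard₂' : ∀ ω ω', ω' ≠ ω → D.cls ω' = D.cls ω →
      Nat.card (M₂ ω ω') = Nat.card (M₂ α β) := by
    intro ω ω' hne hcl
    obtain ⟨t, rfl⟩ := D.exists_smul_point α ω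
    obtain ⟨s, hs, rfl⟩ := D.exists_smul_mate (α := t • α) (β := t • β) (β' := ω')
      (fun h' => hβα (MulAction.injective t h')) hne (by rw [D.cls_smul, h, D.cls_smul]) hcl
    rw [← hcard₂ t α β, ← hcard₂ s (t • α) (t • β), hs]
  have hle : M₂ α β ≤ M₁ α := inf_le_left
  obtain ⟨m, hm⟩ := Subgroup.card_dvd_of_le hle
  have hm1 : m ≠ 1 := by
    rintro rfl
    have : M₂ α β = M₁ α := Subgroup.eq_of_le_of_card_ge hle (by rw [hm, mul_one])
    have hgM : g ∈ M₂ α β := this ▸ ⟨hg, hgα⟩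
    exact hgβ hgM.2
  obtain ⟨q, hq, hqm⟩ := Nat.exists_prime_and_dvd hm1
  have : Fact q.Prime := ⟨hq⟩
  let S : Sylow q (M₁ α) := default
  set R : Subgroup G := (S : Subgroup (M₁ α)).map (M₁ α).subtype with hR
  have hRM : R ≤ M₁ α := Subgroup.map_subtype_le _
  have hRp : IsPGroup q R := S.isPGroup'.map _
  have hRcard : ¬ Nat.card R * q ∣ Nat.card (M₁ α) := by
    rw [hR, Subgroup.card_map_of_injective (M₁ α).subtype_injective,
      ← (S : Subgroup (M₁ α)).card_mul_index, mul_dvd_mul_iff_left Nat.card_pos.ne']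
    exact S.not_dvd_index
  have huniq : ∀ ω ω', D.cls ω' = D.cls ω → (∀ a ∈ R, a • ω = ω) → (∀ a ∈ R, a • ω' = ω') →
      ω' = ω := by
    intro ω ω' hcl h1 h2
    by_contra hne
    have hRle : R ≤ M₂ ω ω' := fun a ha => ⟨⟨(hRM ha).1, h1 a ha⟩, h2 a ha⟩
    refine hRcard ?_
    rw [hm]
    exact mul_dvd_mul (hcard₂' ω ω' hne hcl ▸ Subgroup.card_dvd_of_le hRle) hqm
  have hRα : ∀ a ∈ R, a • α = α := fun a ha => (hRM ha).2
  have hmod : ∀ Δ : 𝓒, c ≡ #{ω ∈ ({ω | D.cls ω = Δ} : Finset Ω) | ∀ a ∈ R, a • ω = ω} [MOD q] := by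
    intro Δ
    have := hRp.card_finset_modEq ({ω | D.cls ω = Δ} : Finset Ω) fun a ha ω hω => by
      simp only [mem_filter, mem_univ, true_and] at hω ⊢
      rw [D.cls_smul, hω, hcls a (hRM ha).1]
    rwa [D.card_cls] at this
  have hc1 : c ≡ 1 [MOD q] := by
    have h1 : #{ω ∈ ({ω | D.cls ω = D.cls α} : Finset Ω) | ∀ a ∈ R, a • ω = ω} = 1 := by
      refine card_eq_one.2 ⟨α, eq_singleton_iff_unique_mem.2 ⟨by simpa using hRα, fun ω hω => ?_⟩⟩
      simp only [mem_filter, mem_univ, true_and] at hω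
      exact huniq α ω hω.1 hRα hω.2
    exact h1 ▸ hmod (D.cls α)
  have hcpos := D.two_lt
  have hqc : q ∣ c - 1 := (Nat.modEq_iff_dvd' (by omega)).1 hc1.symm
  have hqodd : Odd q := by
    rcases hq.eq_two_or_odd' with rfl | h'
    · obtain ⟨r, rfl⟩ := hc
      omega
    · exact h'
  have hpt : ∀ B : 𝓑, (∀ a ∈ R, a • B = B) → D.pts B = ∅ := by
    intro B hB
    by_contra hne
    obtain ⟨ω, hω⟩ := nonempty_iff_ne_empty.2 hne
    obtain ⟨ω', hω', hne', hcl', -⟩ := D.exists_mate hω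
    have hfix : ∀ γ ∈ D.pts B, ∀ a ∈ R, a • γ = γ := by
      intro γ hγ a ha
      obtain ⟨i, hi⟩ := hRp ⟨a, ha⟩
      exact D.smul_eq_of_odd (hqodd.pow (n := i)) (congrArg Subtype.val hi) (hB a ha) hγ
        (hcls a (hRM ha).1 _)
    exact hne' (huniq ω ω' hcl' (hfix ω hω) (hfix ω' hω'))
  rcases hQ q hq hqc with hql | hqb
  · obtain ⟨Δ, hΔ⟩ := exists_ne (D.cls α)
    have hpos : 0 < #{ω ∈ ({ω | D.cls ω = Δ} : Finset Ω) | ∀ a ∈ R, a • ω = ω} := by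
      rw [Nat.pos_iff_ne_zero]
      intro h0
      have := hc1.symm.trans (hmod Δ)
      rw [h0] at this
      exact hq.one_lt.ne' (Nat.dvd_one.1 ((Nat.modEq_zero_iff_dvd).1 this))
    obtain ⟨γ, hγ⟩ := card_pos.1 hpos
    simp only [mem_filter, mem_univ, true_and] at hγ
    have hne : α ≠ γ := by rintro rfl; exact hΔ hγ.1.symm
    have h1 := hRp.card_finset_modEq ({B | α ∈ D.pts B ∧ γ ∈ D.pts B} : Finset 𝓑)
      fun a ha B hB => by
        simp only [mem_filter, mem_univ, true_and] at hB ⊢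
        have h2 := D.smul_mem a hB.1
        have h3 := D.smul_mem a hB.2
        rw [hRα a ha] at h2
        rw [hγ.2 a ha] at h3
        exact ⟨h2, h3⟩
    rw [D.card_pair hne] at h1
    have hpos' : #{B ∈ ({B | α ∈ D.pts B ∧ γ ∈ D.pts B} : Finset 𝓑) | ∀ a ∈ R, a • B = B} ≠ 0 := by
      intro h0
      rw [h0] at h1
      exact hql ((Nat.modEq_zero_iff_dvd).1 h1)
    obtain ⟨B, hB⟩ := card_pos.1 (Nat.pos_of_ne_zero hpos')
    simp only [mem_filter, mem_univ, true_and] at hB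
    have := hB.1.1
    rw [hpt B hB.2] at this
    simp at this
  · have h1 := hRp.card_finset_modEq (univ : Finset 𝓑) fun a ha B hB => mem_univ _
    have hpos' : #{B : 𝓑 | ∀ a ∈ R, a • B = B} ≠ 0 := by
      intro h0
      rw [h0, card_univ] at h1
      exact hqb ((Nat.modEq_zero_iff_dvd).1 h1)
    obtain ⟨B, hB⟩ := card_pos.1 (Nat.pos_of_ne_zero hpos')
    simp only [mem_filter, mem_univ, true_and] at hB
    have h2 := D.card_pts B
    rw [hpt B hB, card_empty] at h2
    omega

/-- An element fixing all classes is trivial. -/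
lemma eq_one_of_forall_smul_cls [Finite G] [FaithfulSMul G Ω] [Nontrivial 𝓒]
    (D : PairedDesign G Ω 𝓑 𝓒 lam k c) {p : ℕ} [Fact p.Prime] (hk : 0 < k) (hc : c = 2 * p)
    (hp2 : p ≠ 2) (hfree : ∀ x : G, x ^ p = 1 → x ≠ 1 → ∀ α : Ω, x • α ≠ α)
    (hQ : ∀ q, q.Prime → q ∣ c - 1 → ¬ q ∣ lam ∨ ¬ q ∣ Fintype.card 𝓑) {g : G}
    (hg : ∀ Δ : 𝓒, g • Δ = Δ) : g = 1 := by
  by_contra hg1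
  set K : Subgroup G := (toPermHom G 𝓒).ker with hK
  have hmemK : ∀ a, a ∈ K ↔ ∀ Δ : 𝓒, a • Δ = Δ := fun a => by
    simp [hK, MonoidHom.mem_ker, Equiv.ext_iff]
  have hcls : ∀ a ∈ K, ∀ Δ : 𝓒, a • Δ = Δ := fun a ha => (hmemK a).1 ha
  have hgK : g ∈ K := (hmemK g).2 hg
  obtain ⟨ω, hω⟩ := exists_smul_ne (Ω := Ω) hg1
  have hstab : ∀ {α β : Ω}, D.cls β = D.cls α → ∀ a ∈ K, a • α = α → a • β = β :=
    fun h a ha hα => D.smul_eq_of_cls_eq K hcls hk (by rw [hc]; exact even_two_mul p) hQ h ha hα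
  have hcα : ∀ a ∈ K, ∀ α, D.cls (a • α) = D.cls α := fun a ha α => by
    rw [D.cls_smul, hcls a ha]
  have horb : orbit K ω = {β | D.cls β = D.cls ω} := by
    ext β
    constructor
    · rintro ⟨a, rfl⟩
      exact hcα a a.2 ω
    · intro hβ
      obtain ⟨b, hb, rfl⟩ := D.exists_mem_smul_eq K hcls hgK hω hβ
      exact ⟨⟨b, hb⟩, rfl⟩
  have hindex : (stabilizer K ω).index = c := by
    rw [index_stabilizer, horb]
    refine .trans ?_ (D.card_cls (D.cls ω))
    rw [← Set.ncard_coe_finset]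
    congr 1
    ext
    simp
  have hpK : p ∣ Nat.card K := by
    rw [← (stabilizer K ω).card_mul_index, hindex, hc]
    exact (dvd_mul_left p 2).mul_left _
  obtain ⟨⟨y, hyK⟩, hyp', hy1'⟩ := exists_pow_eq_one_of_dvd_card hpK
  have hyp : y ^ p = 1 := congrArg Subtype.val hyp'
  have hy1 : y ≠ 1 := fun h => hy1' (Subtype.ext h)
  have hpow : ∀ a ∈ K, a ^ p • ω = ω := by
    intro a ha
    by_cases haω : a • ω = ω
    · exact (stabilizer G ω).pow_mem haω p
    obtain ⟨t, ht, hta⟩ := D.exists_smul_mate (hfree y hyp hy1 ω) haω (hcα y hyK ω) (hcα a ha ω)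
    set b := t * y * t⁻¹ with hb
    have hbK : b ∈ K := (inferInstance : K.Normal).conj_mem y hyK t
    have hbω : b • ω = a • ω := by
      rw [hb, mul_smul, inv_smul_eq_iff.2 ht.symm, mul_smul, hta]
    have hbp : b ^ p = 1 := by rw [hb, conj_pow, hyp]; simp
    have hab : ∀ β, D.cls β = D.cls ω → a • β = b • β := by
      intro β hβ
      have := hstab hβ (b⁻¹ * a) (K.mul_mem (K.inv_mem hbK) ha)
        (by rw [mul_smul, inv_smul_eq_iff, hbω])
      rwa [mul_smul, inv_smul_eq_iff] at this
    have hind : ∀ n : ℕ, a ^ n • ω = b ^ n • ω := by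
      intro n
      induction n with
      | zero => simp
      | succ n ih =>
        rw [pow_succ', pow_succ', mul_smul, mul_smul, ih,
          hab _ (hcα _ (K.pow_mem hbK n) ω)]
    rw [hind, hbp, one_smul]
  have : Fact (Nat.Prime 2) := ⟨Nat.prime_two⟩
  let L : Sylow 2 K := default
  have hL : (L : Subgroup K) ≤ stabilizer K ω := by
    rintro a ha
    obtain ⟨i, hi⟩ := L.isPGroup' ⟨a, ha⟩
    have ha2 : a.1 ^ 2 ^ i = 1 := congrArg (fun z => z.1.1) hi
    have hcop : IsCoprime ((2 ^ i : ℕ) : ℤ) (p : ℤ) := by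
      rw [Nat.isCoprime_iff_coprime]
      exact (((Nat.coprime_primes Nat.prime_two Fact.out).2 hp2.symm).pow_left i)
    obtain ⟨u, w, huw⟩ := hcop
    have hmem : a.1 ^ p ∈ stabilizer G ω := hpow a a.2
    have : a.1 = (a.1 ^ p) ^ w := by
      conv_lhs => rw [← zpow_one a.1, ← huw]
      rw [zpow_add, mul_comm, zpow_mul, zpow_natCast, ha2, one_zpow, one_mul, mul_comm w, zpow_mul,
        zpow_natCast]
    change a.1 • ω = ω
    rw [this]
    exact (stabilizer G ω).zpow_mem hmem w
  refine L.not_dvd_index (dvd_trans ?_ (Subgroup.index_dvd_of_le hL))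
  rw [hindex, hc]
  exact dvd_mul_right 2 p

/-- A set of classes invariant under a point stabilizer has size divisible by `c - 1`, unless it
contains the class of the point. -/
lemma sub_one_dvd_card (D : PairedDesign G Ω 𝓑 𝓒 lam k c) (α : Ω) (O : Finset 𝓒)
    (hO : ∀ g : G, g • α = α → ∀ Δ ∈ O, g • Δ ∈ O) (hα : D.cls α ∉ O) : c - 1 ∣ #O := by
  set S : Finset Ω := {ω | D.cls ω ∈ O} with hS
  have hcard : #S = #O * c := by
    rw [card_eq_sum_card_fiberwise (f := D.cls) (t := O) (by simp [hS, Set.MapsTo])]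
    refine (sum_congr rfl fun Δ hΔ => ?_).trans (sum_const_nat (m := c) fun _ _ => rfl)
    refine .trans ?_ (D.card_cls Δ)
    congr 1
    ext ω
    simp only [hS, mem_filter, mem_univ, true_and, and_iff_right_iff_imp]
    rintro rfl
    exact hΔ
  have hle : ∀ B B', α ∈ D.pts B → α ∈ D.pts B' →
      #{ω ∈ S | ω ∈ D.pts B} ≤ #{ω ∈ S | ω ∈ D.pts B'} := by
    intro B B' hB hB'
    obtain ⟨g, hg, rfl⟩ := D.flag hB hB'
    refine card_le_card_of_injOn (g • ·) (fun ω hω => ?_) (MulAction.injective g).injOn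
    simp only [hS, coe_filter, mem_filter, mem_univ, true_and, Set.mem_ofPred_eq] at hω ⊢
    exact ⟨D.cls_smul g ω ▸ hO g hg _ hω.1, D.smul_mem g hω.2⟩
  obtain ⟨B₀, hB₀⟩ := D.exists_block α
  have h := D.sum_card_inter (γ := α) (S := S) (by simpa [hS] using hα)
  rw [sum_const_nat (m := #{ω ∈ S | ω ∈ D.pts B₀}) fun B hB =>
      (hle _ _ (mem_filter.1 hB).2 hB₀).antisymm (hle _ _ hB₀ (mem_filter.1 hB).2),
    D.card_blocks_through, hcard, mul_assoc] at h
  have h2 := Nat.eq_of_mul_eq_mul_left D.lam_pos h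
  have hc := D.two_lt
  have hcop : (c - 1).Coprime c := by
    have := Nat.coprime_self_add_right (m := c - 1) (n := 1)
    rw [Nat.sub_add_cancel (by omega)] at this
    exact this.2 (Nat.coprime_one_right _)
  exact hcop.dvd_of_dvd_mul_right (Dvd.intro _ h2)

/-- Each block meets `k / 2` classes. -/
lemma card_image_cls (B : 𝓑) : #((D.pts B).image D.cls) * 2 = k := by
  refine .trans ?_ (D.card_pts B)
  rw [card_eq_sum_card_image D.cls, sum_const_nat (m := 2)]
  intro Δ hΔ
  obtain ⟨ω, hω, rfl⟩ := mem_image.1 hΔ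
  exact D.card_meet hω

/-- Counting flags. -/
lemma card_blocks_mul (D : PairedDesign G Ω 𝓑 𝓒 lam k c) :
    Fintype.card 𝓑 * k = Fintype.card Ω * (lam * (c - 1)) := by
  have h := sum_card_bipartiteAbove_eq_sum_card_bipartiteBelow (s := (univ : Finset Ω))
    (t := (univ : Finset 𝓑)) (fun ω B => ω ∈ D.pts B)
  simp only [bipartiteAbove, bipartiteBelow] at h
  rw [sum_const_nat (m := lam * (c - 1)) fun ω _ => D.card_blocks_through ω,
    sum_const_nat (m := k) fun B _ => ?_, card_univ, card_univ] at h
  · exact h.symm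
  · refine .trans ?_ (D.card_pts B)
    congr 1
    ext
    simp

lemma card_points [Fintype 𝓒] (D : PairedDesign G Ω 𝓑 𝓒 lam k c) :
    Fintype.card Ω = Fintype.card 𝓒 * c := by
  rw [← card_univ, card_eq_sum_card_fiberwise (f := D.cls) (t := univ) (by simp [Set.MapsTo]),
    sum_const_nat fun Δ _ => D.card_cls Δ, card_univ]

/-- The point stabilizers have index `c` in the stabilizers of their classes. -/
lemma card_stabilizer_cls [Finite G] [Fintype 𝓒] (α : Ω) :
    Nat.card (stabilizer G (D.cls α)) = Nat.card (stabilizer G α) * c := by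
  have hΩ : IsPretransitive G Ω := ⟨D.exists_smul_point⟩
  have h𝓒 : IsPretransitive G 𝓒 := ⟨D.exists_smul_cls⟩
  have h1 := (stabilizer G α).card_mul_index
  have h2 := (stabilizer G (D.cls α)).card_mul_index
  rw [index_stabilizer_of_transitive] at h1 h2
  rw [Nat.card_eq_fintype_card (α := Ω), D.card_points, ← h2,
    Nat.card_eq_fintype_card (α := 𝓒)] at h1
  have hpos : 0 < Fintype.card 𝓒 := Fintype.card_pos_iff.2 ⟨D.cls α⟩
  refine Nat.eq_of_mul_eq_mul_right hpos ?_
  rw [← h1]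
  ring

/-- Every class is fixed by an element of order `p`, for any prime `p` dividing `c`. -/
lemma exists_pow_eq_one_smul_cls [Finite G] [Fintype 𝓒] (D : PairedDesign G Ω 𝓑 𝓒 lam k c)
    {p : ℕ} [Fact p.Prime] (hp : p ∣ c) (Δ : 𝓒) :
    ∃ x : G, x ^ p = 1 ∧ x ≠ 1 ∧ x • Δ = Δ := by
  obtain ⟨α, rfl⟩ := D.exists_cls_eq Δ
  obtain ⟨x, hx, hx1⟩ := exists_pow_eq_one_of_dvd_card (q := p) (H := stabilizer G (D.cls α))
    (by rw [D.card_stabilizer_cls]; exact hp.mul_left _)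
  exact ⟨x, congrArg Subtype.val hx, fun h => hx1 (Subtype.ext h), x.2⟩

/-- The group is `2`-transitive on the classes if there are exactly `c` of them. -/
lemma isMultiplyPretransitive_two [Fintype 𝓒] (D : PairedDesign G Ω 𝓑 𝓒 lam k c)
    (hd : Fintype.card 𝓒 = c) : IsMultiplyPretransitive G 𝓒 2 := by
  have key : ∀ (α : Ω) (Δ Δ' : 𝓒), Δ ≠ D.cls α → Δ' ≠ D.cls α →
      ∃ g : G, g • α = α ∧ g • Δ = Δ' := by
    intro α Δ Δ' hΔ hΔ'
    set O : Finset 𝓒 := {Γ | ∃ g : G, g • α = α ∧ g • Δ = Γ} with hO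
    have hα : D.cls α ∉ O := by
      simp only [hO, mem_filter, mem_univ, true_and, not_exists, not_and]
      intro g hg h
      refine hΔ (MulAction.injective g (h.trans ?_))
      change D.cls α = g • D.cls α
      rw [← D.cls_smul, hg]
    have hdvd : c - 1 ∣ #O := by
      refine D.sub_one_dvd_card α O (fun g hg Γ hΓ => ?_) hα
      simp only [hO, mem_filter, mem_univ, true_and] at hΓ ⊢
      obtain ⟨h, hh, rfl⟩ := hΓ
      exact ⟨g * h, by rw [mul_smul, hh, hg], mul_smul g h Δ⟩
    have hsub : O ⊆ univ.erase (D.cls α) := fun Γ hΓ =>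
      mem_erase.2 ⟨fun h => hα (h ▸ hΓ), mem_univ _⟩
    have hpos : 0 < #O := card_pos.2 ⟨Δ, by simpa [hO] using ⟨1, by simp, by simp⟩⟩
    have heq := eq_of_subset_of_card_le hsub
      (by rw [card_erase_of_mem (mem_univ _), card_univ, hd]; exact Nat.le_of_dvd hpos hdvd)
    have : Δ' ∈ O := heq ▸ mem_erase.2 ⟨hΔ', mem_univ _⟩
    simpa [hO] using this
  rw [is_two_pretransitive_iff]
  intro Δ₁ Δ₂ Γ₁ Γ₂ hΔ hΓ
  obtain ⟨g, rfl⟩ := D.exists_smul_cls Δ₁ Γ₁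
  obtain ⟨α, hα⟩ := D.exists_cls_eq (g • Δ₁)
  obtain ⟨h, hh, hh'⟩ := key α (g • Δ₂) Γ₂
    (by rw [hα]; exact fun h => hΔ (MulAction.injective g h.symm))
    (by rw [hα]; exact hΓ.symm)
  refine ⟨h * g, ?_, by rw [mul_smul, hh']⟩
  rw [mul_smul, ← hα, ← D.cls_smul, hh]

open scoped Pointwise in
/-- If the group is transitive on sets of `k / 2` classes, then there are at least as many blocks
as such sets. -/
lemma choose_le_card_blocks [Fintype 𝓒] (D : PairedDesign G Ω 𝓑 𝓒 lam k c) {n : ℕ} (hn : n * 2 = k)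
    (h : IsMultiplyPretransitive G 𝓒 n) [Nonempty Ω] :
    (Fintype.card 𝓒).choose n ≤ Fintype.card 𝓑 := by
  have htrans := Set.powersetCard.isPretransitive_of_isMultiplyPretransitive G h
  have hcard : ∀ B, #((D.pts B).image D.cls) = n := fun B => by
    have := D.card_image_cls B
    omega
  obtain ⟨B₀, -⟩ := D.exists_block (Classical.arbitrary Ω)
  let f : 𝓑 → Set.powersetCard 𝓒 n := fun B => ⟨(D.pts B).image D.cls, hcard B⟩
  have hf : Function.Surjective f := by
    intro s
    obtain ⟨g, rfl⟩ := htrans.exists_smul_eq (f B₀) s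
    refine ⟨g • B₀, Subtype.ext ?_⟩
    rw [Set.powersetCard.coe_smul]
    change (D.pts (g • B₀)).image D.cls = g • (D.pts B₀).image D.cls
    ext Δ
    simp only [mem_image, mem_smul_finset]
    constructor
    · rintro ⟨ω, hω, rfl⟩
      refine ⟨D.cls (g⁻¹ • ω), ⟨g⁻¹ • ω, ?_, rfl⟩, ?_⟩
      · simpa using D.smul_mem g⁻¹ hω
      · rw [← D.cls_smul, smul_inv_smul]
    · rintro ⟨_, ⟨ω, hω, rfl⟩, rfl⟩
      exact ⟨g • ω, D.smul_mem g hω, D.cls_smul g ω⟩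
  have := Nat.card_le_card_of_surjective f hf
  rwa [Set.powersetCard.card, Nat.card_eq_fintype_card, Nat.card_eq_fintype_card] at this

/-- There is no such design with `c` classes, `c = 2 * p` and `k = 2 * (p + 1)`, with `p` prime,
for suitable numerical parameters. -/
lemma false_of_card_cls_eq [Finite G] [FaithfulSMul G Ω] [Fintype 𝓒]
    (D : PairedDesign G Ω 𝓑 𝓒 lam k c) {p : ℕ} [Fact p.Prime] (hc : c = 2 * p)
    (hd : Fintype.card 𝓒 = c) (hk : (p + 1) * 2 = k) (hp : lam < p) (hp2 : p ≠ 2)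
    (hlt : 2 * Fintype.card Ω < p * (p - 1) * (k - p))
    (hQ : ∀ q, q.Prime → q ∣ c - 1 → ¬ q ∣ lam ∨ ¬ q ∣ Fintype.card 𝓑)
    (hb : Fintype.card 𝓑 < (2 * p).choose (p + 1)) : False := by
  have hp1 := (Fact.out : p.Prime).two_le
  have hnt : Nontrivial 𝓒 := Fintype.one_lt_card_iff_nontrivial.1 (by omega)
  have hfree : ∀ x : G, x ^ p = 1 → x ≠ 1 → ∀ α : Ω, x • α ≠ α := by
    intro x hx hx1
    obtain ⟨ω, hω⟩ := exists_smul_ne (Ω := Ω) hx1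
    refine D.smul_ne hc hp hp2 ?_ hlt hx hω
    rw [D.card_points, hd, hc]
    exact (dvd_mul_left p 2).mul_right _
  obtain ⟨Δ⟩ : Nonempty 𝓒 := inferInstance
  obtain ⟨x, hx, hx1, hxΔ⟩ := D.exists_pow_eq_one_smul_cls (p := p) (hc ▸ dvd_mul_left p 2) Δ
  have hmod := card_finset_modEq_card_fixed hx (univ : Finset 𝓒) fun _ _ => mem_univ _
  have hdvd : p ∣ #{Γ : 𝓒 | x • Γ = Γ} := by
    rw [card_univ, hd, hc] at hmod
    exact (Nat.modEq_zero_iff_dvd).1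
      (hmod.symm.trans ((Nat.modEq_zero_iff_dvd).2 (dvd_mul_left p 2)))
  have hpos : 0 < #{Γ : 𝓒 | x • Γ = Γ} := card_pos.2 ⟨Δ, by simpa using hxΔ⟩
  have hlt2 : #{Γ : 𝓒 | x • Γ = Γ} < 2 * p := by
    have hle := card_filter_le (univ : Finset 𝓒) (fun Γ => x • Γ = Γ)
    rw [card_univ, hd, hc] at hle
    refine lt_of_le_of_ne hle fun heq => hx1 ?_
    refine D.eq_one_of_forall_smul_cls (by omega) hc hp2 hfree hQ fun Γ => ?_
    refine card_filter_eq_iff.1 (heq.trans ?_) Γ (mem_univ _)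
    rw [card_univ, hd, hc]
  have hfix : #{Γ : 𝓒 | x • Γ = Γ} = p := by
    obtain ⟨m, hm⟩ := hdvd
    rw [hm] at hlt2 hpos ⊢
    have h1 : m < 2 := Nat.lt_of_mul_lt_mul_left (a := p) (by rwa [mul_comm p 2])
    have h2 : 0 < m := Nat.pos_of_mul_pos_left hpos
    obtain rfl : m = 1 := by omega
    exact mul_one p
  have h := isMultiplyPretransitive_of_card_fixed (D.isMultiplyPretransitive_two hd) hp2
    (hd.trans hc) hx hfix
  obtain ⟨α, -⟩ := D.exists_cls_eq Δ
  have : Nonempty Ω := ⟨α⟩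
  have := D.choose_le_card_blocks hk h
  rw [hd, hc] at this
  omega

/-- A lower bound for the number of fixed points of an element of prime order. -/
lemma mod_mul_mod_le_card_fixed [Fintype 𝓒] (D : PairedDesign G Ω 𝓑 𝓒 lam k c) {q : ℕ}
    [Fact q.Prime] {x : G} (hx : x ^ q = 1) :
    Fintype.card 𝓒 % q * (c % q) ≤ #{ω : Ω | x • ω = ω} := by
  have h1 := card_finset_modEq_card_fixed hx (univ : Finset 𝓒) fun _ _ => mem_univ _
  rw [card_univ] at h1
  have h2 : ∀ Δ ∈ ({Δ | x • Δ = Δ} : Finset 𝓒),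
      c % q ≤ #{ω ∈ ({ω | x • ω = ω} : Finset Ω) | D.cls ω = Δ} := by
    intro Δ hΔ
    have hΔ' : x • Δ = Δ := by simpa using hΔ
    have h := card_finset_modEq_card_fixed hx ({ω | D.cls ω = Δ} : Finset Ω) fun ω hω => by
      simp only [mem_filter, mem_univ, true_and] at hω ⊢
      rw [D.cls_smul, hω, hΔ']
    rw [D.card_cls, filter_filter] at h
    rw [filter_filter]
    simp only [and_comm (a := x • _ = _)]
    rw [h]
    exact Nat.mod_le _ _
  refine (Nat.mul_le_mul_right _ ?_).trans (card_mul_le_card_of_le_card_fiber h2)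
  rw [h1]
  exact Nat.mod_le _ _

lemma not_dvd_card_of_le [Finite G] [FaithfulSMul G Ω] [Fintype 𝓒]
    (D : PairedDesign G Ω 𝓑 𝓒 lam k c) {q : ℕ} [Fact q.Prime] (hq : lam < q) (hq2 : q ≠ 2)
    (hle : c ≤ Fintype.card 𝓒 % q * (c % q)) : ¬ q ∣ Nat.card G := by
  intro hdvd
  obtain ⟨x, hx, hx1⟩ := exists_pow_eq_one_of_dvd_card hdvd
  obtain ⟨γ, hγ⟩ := exists_smul_ne (Ω := Ω) hx1
  have h1 := D.card_fixed_lt hx hq hq2 hγ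
  have h2 := D.mod_mul_mod_le_card_fixed hx
  omega

/-- A second criterion for a prime not to divide the group order, using a fixed block. -/
lemma not_dvd_card_of_two_le [Finite G] [FaithfulSMul G Ω] [Fintype 𝓒]
    (D : PairedDesign G Ω 𝓑 𝓒 lam k c) {q : ℕ} [Fact q.Prime] (hq : lam < q) (hq2 : q ≠ 2)
    (hle : 2 ≤ Fintype.card 𝓒 % q * (c % q)) (hk : c ≤ k / 2 % q * 2) : ¬ q ∣ Nat.card G := by
  intro hdvd
  obtain ⟨x, hx, hx1⟩ := exists_pow_eq_one_of_dvd_card hdvd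
  obtain ⟨γ, hγ⟩ := exists_smul_ne (Ω := Ω) hx1
  have h1 := D.card_fixed_lt hx hq hq2 hγ
  have h2 := hle.trans (D.mod_mul_mod_le_card_fixed hx)
  obtain ⟨α, hα, β, hβ, hαβ⟩ := one_lt_card.1 h2
  simp only [mem_filter, mem_univ, true_and] at hα hβ
  obtain ⟨B, hαB, hβB⟩ := D.exists_block_pair hαβ
  have hB := D.smul_block_eq hx hq hαβ hα hβ hαB hβB
  have h3 := card_finset_modEq_card_fixed hx ((D.pts B).image D.cls) fun Δ hΔ => by
    obtain ⟨ω, hω, rfl⟩ := mem_image.1 hΔ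
    rw [← D.cls_smul]
    exact mem_image_of_mem _ (by simpa [hB] using D.smul_mem x hω)
  have h4 := D.card_image_cls B
  have h5 : ∀ Δ ∈ ({Δ ∈ (D.pts B).image D.cls | x • Δ = Δ} : Finset 𝓒),
      2 ≤ #{ω ∈ ({ω | x • ω = ω} : Finset Ω) | D.cls ω = Δ} := by
    intro Δ hΔ
    simp only [mem_filter, mem_image] at hΔ
    obtain ⟨⟨ω, hω, rfl⟩, hfix⟩ := hΔ
    rw [← D.card_meet hω]
    refine card_le_card fun β hβ => ?_
    simp only [mem_filter, mem_univ, true_and] at hβ ⊢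
    exact ⟨D.smul_eq_of_odd ((Fact.out : q.Prime).odd_of_ne_two hq2) hx hB hβ.1 (hβ.2 ▸ hfix), hβ.2⟩
  have h7 := card_mul_le_card_of_le_card_fiber h5
  have h8 : k / 2 % q ≤ #{Δ ∈ (D.pts B).image D.cls | x • Δ = Δ} := by
    have h9 : #((D.pts B).image D.cls) = k / 2 := by omega
    rw [← h9, h3]
    exact Nat.mod_le _ _
  omega

/-- There is no such design with parameters `lam = 4`, `k = 80`, `c = 26` and `76` classes. -/
lemma false_of_card_cls_eq_seventySix [Finite G] [FaithfulSMul G Ω] [Fintype 𝓒]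
    (D : PairedDesign G Ω 𝓑 𝓒 4 80 26) (hd : Fintype.card 𝓒 = 76) : False := by
  have h5 : Fact (Nat.Prime 5) := ⟨by norm_num⟩
  have h7 : Fact (Nat.Prime 7) := ⟨by norm_num⟩
  have h11 : Fact (Nat.Prime 11) := ⟨by norm_num⟩
  have h13 : Fact (Nat.Prime 13) := ⟨by norm_num⟩
  have h23 : Fact (Nat.Prime 23) := ⟨by norm_num⟩
  have h37 : Fact (Nat.Prime 37) := ⟨by norm_num⟩
  have hG7 : ¬ 7 ∣ Nat.card G :=
    D.not_dvd_card_of_le (by norm_num) (by norm_num) (by norm_num [hd])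
  have hG11 : ¬ 11 ∣ Nat.card G :=
    D.not_dvd_card_of_le (by norm_num) (by norm_num) (by norm_num [hd])
  have hG37 : ¬ 37 ∣ Nat.card G :=
    D.not_dvd_card_of_le (by norm_num) (by norm_num) (by norm_num [hd])
  have hG23 : ¬ 23 ∣ Nat.card G :=
    D.not_dvd_card_of_two_le (by norm_num) (by norm_num) (by norm_num [hd]) (by norm_num)
  have hv : Fintype.card Ω = 1976 := by rw [D.card_points, hd]
  have hnt : Nontrivial 𝓒 := Fintype.one_lt_card_iff_nontrivial.1 (by omega)
  have hfree : ∀ x : G, x ^ 13 = 1 → x ≠ 1 → ∀ α : Ω, x • α ≠ α := by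
    intro x hx hx1
    obtain ⟨ω, hω⟩ := exists_smul_ne (Ω := Ω) hx1
    exact D.smul_ne (p := 13) (by norm_num) (by norm_num) (by norm_num) (by rw [hv]; norm_num)
      (by rw [hv]; norm_num) hx hω
  have hstab : ∀ Δ : 𝓒, ¬ 13 ^ 2 ∣ Nat.card (stabilizer G Δ) := by
    intro Δ hdvd
    obtain ⟨α, rfl⟩ := D.exists_cls_eq Δ
    rw [D.card_stabilizer_cls] at hdvd
    have : 13 ∣ Nat.card (stabilizer G α) := by omega
    obtain ⟨x, hx, hx1⟩ := exists_pow_eq_one_of_dvd_card this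
    exact hfree x (congrArg Subtype.val hx) (fun h => hx1 (Subtype.ext h)) α x.2
  obtain ⟨Δ⟩ : Nonempty 𝓒 := inferInstance
  obtain ⟨y, hy, hy1, hyΔ⟩ := D.exists_pow_eq_one_smul_cls (p := 13) (by norm_num) Δ
  set N := Subgroup.normalizer (Subgroup.zpowers y : Set G)
  have hNG : Nat.card N ∣ Nat.card G := Subgroup.card_subgroup_dvd_card N
  have hN5 : ¬ 5 ∣ Nat.card N := by
    intro hdvd
    obtain ⟨z, hz, hz1⟩ := exists_pow_eq_one_of_dvd_card hdvd
    have hz' : z.1 ^ 5 = 1 := congrArg Subtype.val hz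
    obtain ⟨γ, hγ⟩ := exists_smul_ne (Ω := Ω) (x := z.1) fun h => hz1 (Subtype.ext h)
    obtain ⟨w, hw, hw1, hcomm⟩ := exists_commute_of_mem_normalizer (p := 13) (q := 5) (by norm_num)
      hy hy1 hz' z.2
    have hlt := D.card_fixed_lt hz' (by norm_num) (by norm_num) hγ
    have hmod := card_finset_modEq_card_fixed hz' (univ : Finset Ω) fun _ _ => mem_univ _
    rw [card_univ, hv] at hmod
    have hmod' := card_finset_modEq_card_fixed hw ({ω | z.1 • ω = ω} : Finset Ω) fun ω hω => by
      simp only [mem_filter, mem_univ, true_and] at hω ⊢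
      rw [← mul_smul, hcomm.eq, mul_smul, hω]
    rw [filter_false_of_mem fun ω _ => hfree w hw hw1 ω, card_empty] at hmod'
    unfold Nat.ModEq at hmod hmod'
    omega
  have hfixdvd : #{Γ : 𝓒 | y • Γ = Γ} ∣ Nat.card N :=
    card_fixed_dvd_card_normalizer (H := ⊤) (O := univ) (Subgroup.mem_top y) hy hy1
      (fun _ _ _ _ => mem_univ _) (fun a _ b _ => by simpa using D.exists_smul_cls a b)
      (fun a _ => hstab a) ⟨Δ, mem_univ _, hyΔ⟩
  have hfixmod := card_finset_modEq_card_fixed hy (univ : Finset 𝓒) fun _ _ => mem_univ _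
  have hfixle := card_filter_le (univ : Finset 𝓒) (fun Γ => y • Γ = Γ)
  have hfixne : #{Γ : 𝓒 | y • Γ = Γ} ≠ 76 := by
    intro h
    refine hy1 (D.eq_one_of_forall_smul_cls (p := 13) (by norm_num) (by norm_num) (by norm_num) hfree
      (fun q hq h => .inl fun h' => ?_) fun Γ => ?_)
    · have h2 := Nat.dvd_gcd h h'
      exact hq.one_lt.ne' (Nat.dvd_one.1 h2)
    · exact card_filter_eq_iff.1 (h.trans (by rw [card_univ, hd])) Γ (mem_univ _)
  rw [card_univ, hd] at hfixmod hfixle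
  have hfix : #{Γ : 𝓒 | y • Γ = Γ} = 24 := by
    generalize #{Γ : 𝓒 | y • Γ = Γ} = m at *
    unfold Nat.ModEq at hfixmod
    have hcases : m = 11 ∨ m = 24 ∨ m = 37 ∨ m = 50 ∨ m = 63 := by omega
    rcases hcases with rfl | rfl | rfl | rfl | rfl
    · exact absurd (hfixdvd.trans hNG) hG11
    · rfl
    · exact absurd (hfixdvd.trans hNG) hG37
    · exact absurd ((by norm_num : 5 ∣ 50).trans hfixdvd) hN5
    · exact absurd (((by norm_num : 7 ∣ 63).trans hfixdvd).trans hNG) hG7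
  obtain ⟨α, hα⟩ := D.exists_cls_eq Δ
  set orb : 𝓒 → Finset 𝓒 := fun Γ => {Γ' | ∃ g : G, g • Δ = Δ ∧ g • Γ = Γ'} with horb
  have hmem : ∀ Γ Γ', Γ' ∈ orb Γ ↔ ∃ g : G, g • Δ = Δ ∧ g • Γ = Γ' := by simp [horb]
  have hself : ∀ Γ, Γ ∈ orb Γ := fun Γ => (hmem Γ Γ).2 ⟨1, by simp, by simp⟩
  have hΔ : ∀ Γ, Γ ≠ Δ → Δ ∉ orb Γ := by
    intro Γ hΓ h
    obtain ⟨g, hg, hg'⟩ := (hmem _ _).1 h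
    exact hΓ (MulAction.injective g (hg'.trans hg.symm))
  have hinv : ∀ Γ, ∀ g : G, g • Δ = Δ → ∀ Γ' ∈ orb Γ, g • Γ' ∈ orb Γ := by
    intro Γ g hg Γ' hΓ'
    obtain ⟨h, hh, rfl⟩ := (hmem _ _).1 hΓ'
    exact (hmem _ _).2 ⟨g * h, by rw [mul_smul, hh, hg], mul_smul _ _ _⟩
  have hdvd : ∀ Γ, Γ ≠ Δ → 25 ∣ #(orb Γ) := by
    intro Γ hΓ
    refine D.sub_one_dvd_card α (orb Γ) (fun g hg => hinv Γ g ?_) (hα ▸ hΔ Γ hΓ)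
    rw [← hα, ← D.cls_smul, hg]
  have hpos : ∀ Γ, 0 < #(orb Γ) := fun Γ => card_pos.2 ⟨Γ, hself Γ⟩
  have hmod : ∀ Γ, #(orb Γ) ≡ #{Γ' ∈ orb Γ | y • Γ' = Γ'} [MOD 13] := fun Γ =>
    card_finset_modEq_card_fixed hy (orb Γ) fun Γ' => hinv Γ y hyΔ Γ'
  have hfdvd : ∀ Γ, #{Γ' ∈ orb Γ | y • Γ' = Γ'} ≠ 0 →
      #{Γ' ∈ orb Γ | y • Γ' = Γ'} ∣ Nat.card G := by
    intro Γ h0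
    obtain ⟨Γ₀, hΓ₀⟩ := card_pos.1 (Nat.pos_of_ne_zero h0)
    rw [mem_filter] at hΓ₀
    refine dvd_trans ?_ hNG
    refine card_fixed_dvd_card_normalizer (H := stabilizer G Δ) (O := orb Γ) hyΔ hy hy1
      (fun g hg => hinv Γ g hg) ?_ (fun a _ => hstab a) ⟨Γ₀, hΓ₀⟩
    intro a ha b hb
    obtain ⟨g, hg, rfl⟩ := (hmem _ _).1 ha
    obtain ⟨h, hh, rfl⟩ := (hmem _ _).1 hb
    refine ⟨h * g⁻¹, ?_, by rw [mul_smul, inv_smul_smul]⟩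
    rw [mem_stabilizer_iff, mul_smul, inv_smul_eq_iff.2 hg.symm, hh]
  have hbound : ∀ T : Finset 𝓒, Δ ∉ T → #T ≤ 75 ∧ #{Γ ∈ T | y • Γ = Γ} ≤ 23 := by
    intro T hT
    constructor
    · have h := card_le_card (subset_univ (insert Δ T))
      rw [card_insert_of_notMem hT, card_univ, hd] at h
      omega
    · have h : insert Δ {Γ ∈ T | y • Γ = Γ} ⊆ ({Γ : 𝓒 | y • Γ = Γ} : Finset 𝓒) := by
        intro Γ hΓ
        rcases mem_insert.1 hΓ with rfl | hΓ
        · simpa using hyΔ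
        · simpa using (mem_filter.1 hΓ).2
      have h' := card_le_card h
      rw [card_insert_of_notMem fun h => hT (mem_filter.1 h).1, hfix] at h'
      omega
  have horbcard : ∀ Γ, Γ ≠ Δ → #(orb Γ) = 25 ∧ #{Γ' ∈ orb Γ | y • Γ' = Γ'} = 12 := by
    intro Γ hΓ
    obtain ⟨hb1, hb2⟩ := hbound (orb Γ) (hΔ Γ hΓ)
    have h1 := hdvd Γ hΓ
    have h2 := hpos Γ
    have h3 := hmod Γ
    have h4 := hfdvd Γ
    have h75 : #(orb Γ) = 75 → #{Γ' ∈ orb Γ | y • Γ' = Γ'} = 23 := by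
      intro h
      have huniv : insert Δ (orb Γ) = univ := by
        rw [← card_eq_iff_eq_univ, card_insert_of_notMem (hΔ Γ hΓ), h, hd]
      have h' := hfix
      rw [← huniv, filter_insert, if_pos hyΔ,
        card_insert_of_notMem fun h => hΔ Γ hΓ (mem_filter.1 h).1] at h'
      omega
    generalize #{Γ' ∈ orb Γ | y • Γ' = Γ'} = f at *
    generalize #(orb Γ) = n at *
    unfold Nat.ModEq at h3
    have hcases : n = 25 ∨ n = 50 ∨ n = 75 := by omega
    rcases hcases with rfl | rfl | rfl
    · omega
    · obtain rfl : f = 11 := by omega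
      exact absurd (h4 (by norm_num)) hG11
    · obtain rfl := h75 rfl
      exact absurd (h4 (by norm_num)) hG23
  obtain ⟨Γ₁, hΓ₁⟩ := exists_ne Δ
  obtain ⟨h1, h1'⟩ := horbcard Γ₁ hΓ₁
  obtain ⟨Γ₂, -, hΓ₂⟩ := exists_mem_notMem_of_card_lt_card (s := insert Δ (orb Γ₁)) (t := univ)
    (by rw [card_insert_of_notMem (hΔ Γ₁ hΓ₁), h1, card_univ, hd]; norm_num)
  rw [mem_insert, not_or] at hΓ₂
  obtain ⟨-, h2'⟩ := horbcard Γ₂ hΓ₂.1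
  have hdisj : Disjoint (orb Γ₁) (orb Γ₂) := by
    rw [Finset.disjoint_left]
    intro Γ ha hb
    obtain ⟨g, hg, rfl⟩ := (hmem _ _).1 hb
    refine hΓ₂.2 ?_
    simpa using hinv Γ₁ g⁻¹ (inv_smul_eq_iff.2 hg.symm) _ ha
  have hb := (hbound (orb Γ₁ ∪ orb Γ₂) fun h => by
    rcases mem_union.1 h with h | h
    · exact hΔ Γ₁ hΓ₁ h
    · exact hΔ Γ₂ hΓ₂.1 h).2
  rw [filter_union, card_union_of_disjoint (disjoint_filter_filter hdisj), h1', h2'] at hb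
  omega

end PairedDesign

end

/-- The action of a permutation group on an invariant family of finite sets. -/
abbrev imageMulAction {Ω : Type*} [DecidableEq Ω] (G : Subgroup (Equiv.Perm Ω))
    (𝓢 : Finset (Finset Ω)) (h : ∀ g ∈ G, ∀ S ∈ 𝓢, S.image ⇑g ∈ 𝓢) : MulAction G 𝓢 where
  smul g S := ⟨S.1.image ⇑g.1, h g.1 g.2 S.1 S.2⟩
  one_smul S := Subtype.ext (Finset.image_id (s := S.1))
  mul_smul g g' S := Subtype.ext (Finset.image_image (s := S.1) (f := ⇑g'.1) (g := ⇑g.1)).symm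

theorem stmt_18
    {Ω : Type*} [Fintype Ω] [DecidableEq Ω]
    (v k lam c d ℓ : ℕ)
    (𝓑 𝓒 : Finset (Finset Ω))
    (G : Subgroup (Equiv.Perm Ω))
    (hv : Fintype.card Ω = v)
    (hlam1 : 1 ≤ lam)
    (hkcard : ∀ B ∈ 𝓑, B.card = k)
    (hpairs : ∀ α β : Ω, α ≠ β → (𝓑.filter (fun B => α ∈ B ∧ β ∈ B)).card = lam)
    (hk2 : 2 < k) (hkv : k < v)
    (hGB : ∀ g ∈ G, ∀ B ∈ 𝓑, B.image ⇑g ∈ 𝓑)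
    (hflag : ∀ B₁ ∈ 𝓑, ∀ B₂ ∈ 𝓑, ∀ α₁ ∈ B₁, ∀ α₂ ∈ B₂,
        ∃ g ∈ G, B₁.image ⇑g = B₂ ∧ g α₁ = α₂)
    (hpart : ∀ ω : Ω, ∃! Δ, Δ ∈ 𝓒 ∧ ω ∈ Δ)
    (hdcard : 𝓒.card = d) (hd2 : 2 ≤ d)
    (hccard : ∀ Δ ∈ 𝓒, Δ.card = c) (hc2 : 2 ≤ c)
    (hGC : ∀ g ∈ G, ∀ Δ ∈ 𝓒, Δ.image ⇑g ∈ 𝓒)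
    (hl2 : 2 ≤ ℓ)
    (hlcap : ∀ B ∈ 𝓑, ∀ Δ ∈ 𝓒, (B ∩ Δ).Nonempty → (B ∩ Δ).card = ℓ)
    (htuple : (lam, v, k, c, d, ℓ) = (3, 1156, 36, 34, 34, 2) ∨
      (lam, v, k, c, d, ℓ) = (4, 1976, 80, 26, 76, 2) ∨
      (lam, v, k, c, d, ℓ) = (4, 2116, 48, 46, 46, 2))
    : False := by
  obtain ⟨hℓ, hc⟩ : ℓ = 2 ∧ 2 < c := by
    rcases htuple with h | h | h <;> simp only [Prod.mk.injEq] at h <;> omega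
  subst hℓ
  let _ : MulAction G 𝓑 := imageMulAction G 𝓑 hGB
  let _ : MulAction G 𝓒 := imageMulAction G 𝓒 hGC
  choose cls hcls hcls' using hpart
  have hiff : ∀ (ω : Ω) (Δ : 𝓒), (⟨cls ω, (hcls ω).1⟩ : 𝓒) = Δ ↔ ω ∈ Δ.1 := fun ω Δ =>
    ⟨fun h => h ▸ (hcls ω).2, fun h => Subtype.ext (hcls' ω Δ.1 ⟨Δ.2, h⟩).symm⟩
  have D : PairedDesign G Ω 𝓑 𝓒 lam k c :=
    { pts := fun B => B.1
      cls := fun ω => ⟨cls ω, (hcls ω).1⟩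
      lam_pos := hlam1
      two_lt := hc
      smul_mem := fun g ω B h => Finset.mem_image_of_mem _ h
      cls_smul := fun g ω => (hiff _ _).2 (Finset.mem_image_of_mem _ (hcls ω).2)
      card_pair := by
        intro α β h
        rw [← hpairs α β h]
        refine Finset.card_nbij Subtype.val ?_ Subtype.val_injective.injOn ?_
        · intro B hB
          simpa using hB
        · intro B hB
          simp only [Finset.coe_filter, Set.mem_ofPred_eq] at hB
          exact ⟨⟨B, hB.1⟩, by simpa using hB.2, rfl⟩
      card_pts := fun B => hkcard B.1 B.2
      card_meet := by
        intro B ω hω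
        rw [← hlcap B.1 B.2 (cls ω) (hcls ω).1 ⟨ω, Finset.mem_inter.2 ⟨hω, (hcls ω).2⟩⟩]
        congr 1
        ext β
        simp only [Finset.mem_filter, Finset.mem_inter, hiff]
      card_cls := by
        intro Δ
        rw [← hccard Δ.1 Δ.2]
        congr 1
        ext ω
        simp only [Finset.mem_filter, Finset.mem_univ, true_and, hiff]
      flag := by
        intro B B' α α' hα hα'
        obtain ⟨g, hg, h1, h2⟩ := hflag B.1 B.2 B'.1 B'.2 α hα α' hα'
        exact ⟨⟨g, hg⟩, h2, Subtype.ext h1⟩ }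
  have hd : Fintype.card 𝓒 = d := by rw [Fintype.card_coe, hdcard]
  have hb := D.card_blocks_mul
  rcases htuple with h | h | h <;> simp only [Prod.mk.injEq] at h <;>
    obtain ⟨rfl, rfl, rfl, rfl, rfl, -⟩ := h
  · have : Fact (Nat.Prime 17) := ⟨by norm_num⟩
    have hb' : Fintype.card 𝓑 = 3179 := by omega
    refine D.false_of_card_cls_eq (p := 17) rfl hd rfl (by norm_num) (by norm_num)
      (by rw [hv]; norm_num) (fun q hq h => ?_) (by rw [hb']; decide)
    rw [hb', ← not_and_or]
    rintro ⟨h1, h2⟩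
    exact hq.one_lt.ne' (Nat.dvd_one.1 (Nat.dvd_gcd h1 h2))
  · exact D.false_of_card_cls_eq_seventySix hd
  · have : Fact (Nat.Prime 23) := ⟨by norm_num⟩
    have hb' : Fintype.card 𝓑 = 7935 := by omega
    refine D.false_of_card_cls_eq (p := 23) rfl hd rfl (by norm_num) (by norm_num)
      (by rw [hv]; norm_num) (fun q hq h => .inl fun h' => ?_) (by rw [hb']; decide)
    exact hq.one_lt.ne' (Nat.dvd_one.1 (Nat.dvd_gcd h h'))
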